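/- Let 𝓛 be a relational first-order language and let A and C be 𝓛-structures. Suppose there is at least one copy of C in A, and that C has a proper subset of its domain whose induced structure is isomorphic to C. Then there exists a function F from the copies of C in A to Bool such that no copy of C in A is homogeneous for F. -/

import Mathlib

open FirstOrder FirstOrder.Language

/-- The induced structure on a subset of a structure for a relational language:
each relation symbol is interpreted by restriction. -/
def inducedStructureOn {L : Language} [L.IsRelational] {M : Type*} [L.Structure M]
    (X : Set M) : L.Structure X where
  funMap := fun {_} f _ => isEmptyElim f
  RelMap := fun {_} r x => Structure.RelMap r (fun i => (x i : M))

/-- `X` is a copy of `C` in `A`: the induced structure on `X ⊆ A` is isomorphic to `C`. -/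
def IsCopyOf {L : Language} [L.IsRelational] {A C : Type*} [L.Structure A] [L.Structure C]
    (X : Set A) : Prop :=
  Nonempty (@Language.Equiv L X C (inducedStructureOn X) _)

/-- A map none of whose iterates ever repeat along an orbit admits a 2-colouring that changes at
every step. -/
theorem exists_bool_coloring_ne_apply {P : Type*} (f : P → P)
    (hf : ∀ p, Function.Injective fun n : ℕ => f^[n] p) :
    ∃ F : P → Bool, ∀ p, F (f p) ≠ F p := by
  classical
  let s : Setoid P :=
    { r := fun p q => ∃ m n : ℕ, f^[m] p = f^[n] q
      iseqv :=
        { refl := fun p => ⟨0, 0, rfl⟩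
          symm := fun ⟨m, n, h⟩ => ⟨n, m, h.symm⟩
          trans := by
            rintro p q r ⟨m, n, h⟩ ⟨m', n', h'⟩
            refine ⟨m' + m, n + n', ?_⟩
            rw [Function.iterate_add_apply, h, ← Function.iterate_add_apply, add_comm m' n,
              Function.iterate_add_apply, h', ← Function.iterate_add_apply] } }
  let root : P → P := fun p => (Quotient.mk s p).out
  have root_apply (p : P) : root (f p) = root p := by
    have h : Quotient.mk s (f p) = Quotient.mk s p := Quotient.sound ⟨0, 1, rfl⟩
    simp only [root, h]
  refine ⟨fun p => decide (∃ m n : ℕ, f^[m] p = f^[n] (root p) ∧ Even (m + n)), fun p hp => ?_⟩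
  simp only [root_apply, decide_eq_decide] at hp
  have not_both : ¬ ((∃ m n : ℕ, f^[m] (f p) = f^[n] (root p) ∧ Even (m + n)) ∧
      ∃ m n : ℕ, f^[m] p = f^[n] (root p) ∧ Even (m + n)) := by
    rintro ⟨⟨m', n', h', e'⟩, m, n, h, e⟩
    rw [← Function.iterate_succ_apply] at h'
    have key : f^[n' + m] p = f^[n + (m' + 1)] p := by
      rw [Function.iterate_add_apply, h, Function.iterate_add_apply f n (m' + 1), h',
        ← Function.iterate_add_apply, ← Function.iterate_add_apply, add_comm]
    have := hf p key
    grind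
  obtain ⟨m, n, h⟩ : ∃ m n : ℕ, f^[m] p = f^[n] (root p) :=
    s.symm (Quotient.mk_out (s := s) p)
  rcases Nat.even_or_odd (m + n) with e | e
  · exact not_both ⟨hp.2 ⟨m, n, h, e⟩, m, n, h, e⟩
  · have h' : ∃ m n : ℕ, f^[m] (f p) = f^[n] (root p) ∧ Even (m + n) := by
      refine ⟨m, n + 1, ?_, by grind⟩
      rw [← Function.iterate_succ_apply, Function.iterate_succ_apply', h,
        Function.iterate_succ_apply']
    exact not_both ⟨h', hp.1 h'⟩

/-- Every preorder without minimal elements has a 2-colouring with no monochromatic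
principal lower set. -/
theorem exists_bool_coloring_of_noMinOrder (P : Type*) [Preorder P] [NoMinOrder P] :
    ∃ F : P → Bool, ∀ p, ∃ q < p, F q ≠ F p := by
  choose f hf using fun p : P => exists_lt p
  obtain ⟨F, hF⟩ := exists_bool_coloring_ne_apply f fun p =>
    (strictAnti_nat_of_succ_lt fun n => by
      simpa only [Function.iterate_succ_apply'] using hf (f^[n] p)).injective
  exact ⟨F, fun p => ⟨f p, hf p, hF p⟩⟩

/-- Copies of `C` in `A` are exactly the ranges of embeddings of `C` into `A`. -/
theorem isCopyOf_iff_exists_range {L : Language} [L.IsRelational] {A C : Type*} [L.Structure A]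
    [L.Structure C] {X : Set A} :
    IsCopyOf (L := L) (C := C) X ↔ ∃ g : C ↪[L] A, Set.range g = X := by
  constructor
  · rintro ⟨e⟩
    let := inducedStructureOn (L := L) X
    let i : X ↪[L] A :=
      { toFun := Subtype.val
        inj' := Subtype.val_injective
        map_fun' := fun f => isEmptyElim f
        map_rel' := fun _ _ => Iff.rfl }
    refine ⟨i.comp e.symm.toEmbedding, ?_⟩
    ext a
    constructor
    · rintro ⟨c, rfl⟩
      exact (e.symm c).2
    · intro ha
      exact ⟨e ⟨a, ha⟩, congrArg Subtype.val (e.symm_apply_apply ⟨a, ha⟩)⟩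
  · rintro ⟨g, rfl⟩
    let := inducedStructureOn (L := L) (Set.range g)
    let e : C ≃[L] Set.range g :=
      { Equiv.ofInjective g g.injective with
        map_fun' := fun f => isEmptyElim f
        map_rel' := fun r x => g.map_rel r x }
    exact ⟨e.symm⟩

/-- Proposition 1.1: if there is a copy of `C` in `A` and `C` has a proper subset of its
domain whose induced structure is isomorphic to `C`, then there is a colouring of the
copies of `C` in `A` with no homogeneous copy. -/
theorem stmt_1 {L : Language} [L.IsRelational] {A C : Type*} [L.Structure A] [L.Structure C]
    (hcopy : ∃ X : Set A, IsCopyOf (L := L) (C := C) X)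
    (hproper : ∃ Y : Set C, Y ≠ Set.univ ∧ IsCopyOf (L := L) (C := C) Y) :
    ∃ F : {X : Set A // IsCopyOf (L := L) (C := C) X} → Bool,
      ∀ X : {X : Set A // IsCopyOf (L := L) (C := C) X},
        ¬ ∀ Y Z : {X : Set A // IsCopyOf (L := L) (C := C) X},
          (Y : Set A) ⊆ (X : Set A) → (Z : Set A) ⊆ (X : Set A) → F Y = F Z := by
  obtain ⟨Y, hY, hYC⟩ := hproper
  obtain ⟨h, rfl⟩ := isCopyOf_iff_exists_range.1 hYC
  have : NoMinOrder {X : Set A // IsCopyOf (L := L) (C := C) X} := by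
    refine ⟨fun ⟨X, hX⟩ => ?_⟩
    obtain ⟨g, rfl⟩ := isCopyOf_iff_exists_range.1 hX
    refine ⟨⟨Set.range (g.comp h), isCopyOf_iff_exists_range.2 ⟨_, rfl⟩⟩, ?_⟩
    change Set.range (g ∘ h) ⊂ Set.range g
    rw [Set.range_comp, ← Set.image_univ (f := g)]
    exact g.injective.image_strictMono (Set.ssubset_univ_iff.2 hY)
  obtain ⟨F, hF⟩ := exists_bool_coloring_of_noMinOrder {X : Set A // IsCopyOf (L := L) (C := C) X}
  refine ⟨F, fun X hX => ?_⟩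
  obtain ⟨Z, hZ, hne⟩ := hF X
  exact hne (hX Z X hZ.le subset_rfl)
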